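/- Krom prefix-extension lemma: suppose ≤ is a linear order on the set of all literals over V (|V| = n) such that l ⟶* l' in the implication graph of Γ implies l ≤ l'. For each variable v let m(v) be the smaller of v and ¬v with respect to ≤, and let l_1 < l_2 < ⋯ < l_n list the set {m(v) : v ∈ V} in increasing order (so each variable has exactly one of its literals among l_1, …, l_n). For 0 ≤ i ≤ n and y ∈ {0,1}^i, there exists an assignment σ satisfying Γ with σ(l_j) = y_j for all 1 ≤ j ≤ i if and only if the assignment τ defined by τ(l_j) = y_j for j ≤ i and, for i < j ≤ n, τ(l_j) = 1 if l_k ⟶* l_j for some k ≤ i with y_k = 1 and τ(l_j) = 0 otherwise, satisfies Γ. -/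

import Mathlib

/-- A literal over the variable set `V`: `(true, v)` is the variable `v` itself and
`(false, v)` is its negation `¬v`. -/
abbrev Lit (V : Type) := Bool × V

/-- Negation of a literal (so that `¬¬v = v`). -/
def Lit.neg {V : Type} (l : Lit V) : Lit V := (!l.1, l.2)

/-- The value of a literal under an assignment `σ : V → {0,1}`
(with `σ(¬v) = 1 - σ(v)`). -/
def evalLit {V : Type} (σ : V → Bool) (l : Lit V) : Bool :=
  if l.1 then σ l.2 else !(σ l.2)

/-- `σ` satisfies the Krom formula `Γ` (a finite set of 2-clauses `(l ∨ l')`):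
every clause contains a literal with value `1`. -/
def Satisfies {V : Type} (σ : V → Bool) (Γ : Finset (Lit V × Lit V)) : Prop :=
  ∀ c ∈ Γ, evalLit σ c.1 = true ∨ evalLit σ c.2 = true

/-- The arc relation of the implication graph of `Γ`: each clause `(l ∨ l')` contributes
the two arcs `¬l → l'` and `¬l' → l`. -/
def Arc {V : Type} (Γ : Finset (Lit V × Lit V)) (l l' : Lit V) : Prop :=
  ∃ c ∈ Γ, (l = Lit.neg c.1 ∧ l' = c.2) ∨ (l = Lit.neg c.2 ∧ l' = c.1)

/-- Reachability `l ⟶* l'` in the implication graph of `Γ`: the reflexive-transitive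
closure of the arc relation. -/
def Reach {V : Type} (Γ : Finset (Lit V × Lit V)) : Lit V → Lit V → Prop :=
  Relation.ReflTransGen (Arc Γ)

theorem Lit.neg_neg {V : Type} (l : Lit V) : l.neg.neg = l := by
  simp [Lit.neg]

theorem Lit.neg_ne {V : Type} (l : Lit V) : l ≠ l.neg := by
  intro h
  have := congrArg Prod.fst h
  simp [Lit.neg] at this

theorem evalLit_neg {V : Type} (σ : V → Bool) (l : Lit V) :
    evalLit σ l.neg = !evalLit σ l := by
  rcases l with ⟨b, v⟩
  cases b <;> simp [evalLit, Lit.neg]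

theorem Lit.eq_or_eq_neg {V : Type} {l l' : Lit V} (h : l'.2 = l.2) :
    l = l' ∨ l = l'.neg := by
  rcases l with ⟨b, v⟩
  rcases l' with ⟨b', v'⟩
  obtain rfl : v' = v := h
  cases b <;> cases b' <;> simp [Lit.neg]

theorem Satisfies.evalLit_of_arc {V : Type} {σ : V → Bool} {Γ : Finset (Lit V × Lit V)}
    (hσ : Satisfies σ Γ) {l l' : Lit V} (h : Arc Γ l l') (hl : evalLit σ l = true) :
    evalLit σ l' = true := by
  obtain ⟨c, hc, ⟨rfl, rfl⟩ | ⟨rfl, rfl⟩⟩ := h <;>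
  · rw [evalLit_neg] at hl
    have := hσ c hc
    simp_all

theorem Satisfies.evalLit_of_reach {V : Type} {σ : V → Bool} {Γ : Finset (Lit V × Lit V)}
    (hσ : Satisfies σ Γ) {l l' : Lit V} (h : Reach Γ l l') (hl : evalLit σ l = true) :
    evalLit σ l' = true := by
  induction h with
  | refl => exact hl
  | tail _ hbc ih => exact hσ.evalLit_of_arc hbc ih

/-- Krom prefix-extension lemma. Let `≤` be a linear order on the literals
over `V` (`|V| = n`) such that `l ⟶* l'` implies `l ≤ l'`, and let `l_1 < ⋯ < l_n`
(here `ℓ : Fin n → Lit V`) list, in increasing order, the smaller literal `m(v)` of each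
variable `v`. For `0 ≤ i ≤ n` and `y ∈ {0,1}^i`, there is an assignment `σ` satisfying
`Γ` with `σ(l_j) = y_j` for all `j ≤ i` iff the assignment `τ`, defined by
`τ(l_j) = y_j` for `j ≤ i` and, for `i < j ≤ n`, `τ(l_j) = 1` iff `l_k ⟶* l_j` for
some `k ≤ i` with `y_k = 1`, satisfies `Γ`. -/
theorem krom_prefix_extension {V : Type} [Fintype V] (n : ℕ) (hcard : Fintype.card V = n)
    (Γ : Finset (Lit V × Lit V))
    (le : Lit V → Lit V → Prop) (hlin : IsLinearOrder (Lit V) le)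
    (hcompat : ∀ l l' : Lit V, Reach Γ l l' → le l l')
    (ℓ : Fin n → Lit V)
    (hmono : ∀ j k : Fin n, j < k → le (ℓ j) (ℓ k) ∧ ℓ j ≠ ℓ k)
    (hmin : ∀ j : Fin n, le (ℓ j) (Lit.neg (ℓ j)))
    (hcover : ∀ v : V, ∃ j : Fin n, (ℓ j).2 = v)
    (i : ℕ) (hi : i ≤ n) (y : Fin n → Bool)
    (τ : V → Bool)
    (hτ₁ : ∀ j : Fin n, (j : ℕ) < i → evalLit τ (ℓ j) = y j)
    (hτ₂ : ∀ j : Fin n, i ≤ (j : ℕ) →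
      (evalLit τ (ℓ j) = true ↔
        ∃ k : Fin n, (k : ℕ) < i ∧ y k = true ∧ Reach Γ (ℓ k) (ℓ j))) :
    (∃ σ : V → Bool, Satisfies σ Γ ∧
        ∀ j : Fin n, (j : ℕ) < i → evalLit σ (ℓ j) = y j) ↔
      Satisfies τ Γ := by
  refine ⟨?_, fun hτ => ⟨τ, hτ, hτ₁⟩⟩
  rintro ⟨σ, hσ, hσy⟩
  have eval_of_eval (j : Fin n) (hj : evalLit τ (ℓ j) = true) : evalLit σ (ℓ j) = true := by
    rcases lt_or_ge (j : ℕ) i with hji | hji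
    · rw [hσy j hji, ← hτ₁ j hji, hj]
    · obtain ⟨k, hk, hyk, hkj⟩ := (hτ₂ j hji).1 hj
      exact hσ.evalLit_of_reach hkj (by rw [hσy k hk, hyk])
  have eval_of_arc (j k : Fin n) (hjk : Arc Γ (ℓ j) (ℓ k)) (hj : evalLit τ (ℓ j) = true) :
      evalLit τ (ℓ k) = true := by
    rcases lt_or_ge (k : ℕ) i with hki | hki
    · rw [hτ₁ k hki, ← hσy k hki]
      exact hσ.evalLit_of_arc hjk (eval_of_eval j hj)
    · rw [hτ₂ k hki]
      rcases lt_or_ge (j : ℕ) i with hji | hji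
      · exact ⟨j, hji, by rw [← hτ₁ j hji, hj], Relation.ReflTransGen.single hjk⟩
      · obtain ⟨m, hm, hym, hmj⟩ := (hτ₂ j hji).1 hj
        exact ⟨m, hm, hym, hmj.tail hjk⟩
  intro c hc
  have arc₁ : Arc Γ c.1.neg c.2 := ⟨c, hc, Or.inl ⟨rfl, rfl⟩⟩
  have arc₂ : Arc Γ c.2.neg c.1 := ⟨c, hc, Or.inr ⟨rfl, rfl⟩⟩
  have sat := hσ c hc
  obtain ⟨j, hj⟩ := hcover c.1.2
  obtain ⟨k, hk⟩ := hcover c.2.2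
  rcases Lit.eq_or_eq_neg hj with h₁ | h₁ <;> rcases Lit.eq_or_eq_neg hk with h₂ | h₂ <;>
    rw [h₁, h₂] at arc₁ arc₂ sat ⊢ <;>
    try simp only [Lit.neg_neg, evalLit_neg] at arc₁ arc₂ sat ⊢
  · have le₁ := hcompat _ _ (Relation.ReflTransGen.single arc₁)
    have le₂ := hcompat _ _ (Relation.ReflTransGen.single arc₂)
    have le₃ : le (ℓ k).neg (ℓ k) :=
      hlin.trans _ _ _ le₂ (hlin.trans _ _ _ (hmin j) le₁)
    exact absurd (hlin.antisymm _ _ (hmin k) le₃) (Lit.neg_ne _)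
  · have := eval_of_arc k j arc₂
    grind
  · have := eval_of_arc j k arc₁
    grind
  · have := eval_of_eval j
    have := eval_of_eval k
    grind
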